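/- Let r ≥ 1, let S ⊆ ℤ^r be finite, let a : S → ℂ, let c ∈ (ℂ*)^r and let v ∈ ℤ^r be nonzero. Then the coset C(c,v) is disjoint from Z(p_a) if and only if there is exactly one integer d with Q_{a,v,d}(c) ≠ 0. -/

import Mathlib

open scoped BigOperators

noncomputable section

/-- The Laurent monomial `z^I = ∏ i, z i ^ (I i)` with integer exponents. -/
def lmon {r : ℕ} (z : Fin r → ℂ) (I : Fin r → ℤ) : ℂ :=
  ∏ i, z i ^ (I i)

/-- The Laurent polynomial `p_a(z) = Σ_{I ∈ S} a(I) z^I`. -/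
def pa {r : ℕ} (S : Finset (Fin r → ℤ)) (a : (Fin r → ℤ) → ℂ) (z : Fin r → ℂ) : ℂ :=
  ∑ I ∈ S, a I * lmon z I

/-- The algebraic torus `(ℂ*)^r`, as a subset of `ℂ^r`. -/
def torus (r : ℕ) : Set (Fin r → ℂ) := {z | ∀ i, z i ≠ 0}

/-- The zero set `Z(p_a) = {z ∈ (ℂ*)^r : p_a(z) = 0}`. -/
def Zset {r : ℕ} (S : Finset (Fin r → ℤ)) (a : (Fin r → ℤ) → ℂ) : Set (Fin r → ℂ) :=
  {z | (∀ i, z i ≠ 0) ∧ pa S a z = 0}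

/-- The coset `C(c,v) = {(c_1 t^{v_1}, …, c_r t^{v_r}) : t ∈ ℂ*}` of a
one-dimensional subtorus (for `c ∈ (ℂ*)^r` and `v ∈ ℤ^r` nonzero). -/
def coset {r : ℕ} (c : Fin r → ℂ) (v : Fin r → ℤ) : Set (Fin r → ℂ) :=
  {z | ∃ t : ℂ, t ≠ 0 ∧ z = fun i => c i * t ^ (v i)}

/-- The grouped coefficient `Q_{a,v,d}(c) = Σ_{I ∈ S, ⟨I,v⟩ = d} a(I) c^I`. -/
def Qc {r : ℕ} (S : Finset (Fin r → ℤ)) (a : (Fin r → ℤ) → ℂ) (v : Fin r → ℤ)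
    (d : ℤ) (c : Fin r → ℂ) : ℂ :=
  ∑ I ∈ S.filter (fun I => (∑ i, I i * v i) = d), a I * lmon c I

/-- A one-variable Laurent polynomial over `ℂ` without zeros in `ℂ*`, written with nonzero
coefficients only, has exactly one term. -/
theorem exists_eq_singleton_of_sum_zpow_ne_zero (D : Finset ℤ) (q : ℤ → ℂ)
    (hq : ∀ d ∈ D, q d ≠ 0) (h : ∀ t : ℂ, t ≠ 0 → ∑ d ∈ D, q d * t ^ d ≠ 0) :
    ∃ m, D = {m} := by
  have hD : D.Nonempty := by
    rw [Finset.nonempty_iff_ne_empty]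
    rintro rfl
    exact h 1 one_ne_zero (by simp)
  set m := D.min' hD
  have hmD : m ∈ D := D.min'_mem hD
  have hle : ∀ d ∈ D, m ≤ d := fun d hd => D.min'_le d hd
  let P : Polynomial ℂ := ∑ d ∈ D, Polynomial.monomial (d - m).toNat (q d)
  have hcoeff : ∀ d ∈ D, P.coeff (d - m).toNat = q d := by
    intro d hd
    simp only [P, Polynomial.finsetSum_coeff, Polynomial.coeff_monomial]
    rw [Finset.sum_eq_single_of_mem d hd, if_pos rfl]
    intro e he hne
    have h1 := hle d hd
    have h2 := hle e he
    exact if_neg (by omega)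
  have heval : ∀ t : ℂ, t ≠ 0 → P.eval t * t ^ m = ∑ d ∈ D, q d * t ^ d := by
    intro t ht
    simp only [P, Polynomial.eval_finsetSum, Polynomial.eval_monomial, Finset.sum_mul]
    refine Finset.sum_congr rfl fun d hd => ?_
    have h1 := hle d hd
    rw [mul_assoc, ← zpow_natCast, ← zpow_add₀ ht]
    congr 2
    omega
  have hroot : ∀ t : ℂ, ¬ P.IsRoot t := by
    intro t hPt
    by_cases ht : t = 0
    · subst ht
      have h0 := hcoeff m hmD
      rw [sub_self, Int.toNat_zero, Polynomial.coeff_zero_eq_eval_zero] at h0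
      exact hq m hmD (h0.symm.trans hPt)
    · exact h t ht (by rw [← heval t ht, hPt.eq_zero, zero_mul])
  have hdeg : P.degree = 0 := by
    by_contra hne
    obtain ⟨t, ht⟩ := IsAlgClosed.exists_root P hne
    exact hroot t ht
  refine ⟨m, Finset.eq_singleton_iff_unique_mem.2 ⟨hmD, fun d hd => ?_⟩⟩
  by_contra hne
  have h1 := hle d hd
  have hpos : 0 < (d - m).toNat := by omega
  refine hq d hd ?_
  rw [← hcoeff d hd]
  exact Polynomial.coeff_eq_zero_of_degree_lt (by rw [hdeg]; exact_mod_cast hpos)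

/-- Monomials restricted to a coset of a one-dimensional subtorus. -/
theorem lmon_mul_zpow {r : ℕ} (c : Fin r → ℂ) (v I : Fin r → ℤ) {t : ℂ} (ht : t ≠ 0) :
    lmon (fun i => c i * t ^ v i) I = lmon c I * t ^ (∑ i, I i * v i) := by
  have hsum : ∀ s : Finset (Fin r), t ^ (∑ i ∈ s, I i * v i) = ∏ i ∈ s, t ^ (I i * v i) := by
    intro s
    induction s using Finset.cons_induction with
    | empty => simp
    | cons i s hi ih => rw [Finset.sum_cons, Finset.prod_cons, zpow_add₀ ht, ih]
  simp only [lmon, hsum, ← Finset.prod_mul_distrib]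
  refine Finset.prod_congr rfl fun i _ => ?_
  rw [mul_zpow, ← zpow_mul, mul_comm (v i)]

/-- The finite set of degrees with nonzero grouped coefficient. -/
def degreeSupport {r : ℕ} (S : Finset (Fin r → ℤ)) (a : (Fin r → ℤ) → ℂ) (v : Fin r → ℤ)
    (c : Fin r → ℂ) : Finset ℤ :=
  open Classical in (S.image fun I => ∑ i, I i * v i).filter fun d => Qc S a v d c ≠ 0

theorem mem_degreeSupport {r : ℕ} {S : Finset (Fin r → ℤ)} {a : (Fin r → ℤ) → ℂ}
    {v : Fin r → ℤ} {c : Fin r → ℂ} {d : ℤ} :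
    d ∈ degreeSupport S a v c ↔ Qc S a v d c ≠ 0 := by
  classical
  simp only [degreeSupport, Finset.mem_filter, and_iff_right_iff_imp]
  intro hd
  obtain ⟨I, hI, -⟩ := Finset.exists_ne_zero_of_sum_ne_zero hd
  rw [Finset.mem_filter] at hI
  exact Finset.mem_image.2 ⟨I, hI⟩

/-- The restriction of a Laurent polynomial to a coset of a one-dimensional subtorus is the
one-variable Laurent polynomial formed by the grouped coefficients. -/
theorem pa_mul_zpow {r : ℕ} (S : Finset (Fin r → ℤ)) (a : (Fin r → ℤ) → ℂ)
    (c : Fin r → ℂ) (v : Fin r → ℤ) {t : ℂ} (ht : t ≠ 0) :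
    pa S a (fun i => c i * t ^ v i) = ∑ d ∈ degreeSupport S a v c, Qc S a v d c * t ^ d := by
  classical
  have hsub : degreeSupport S a v c ⊆ S.image fun I => ∑ i, I i * v i := by
    unfold degreeSupport
    exact Finset.filter_subset _ _
  rw [Finset.sum_subset hsub fun d _ hd => by
    rw [mem_degreeSupport, not_not] at hd
    rw [hd, zero_mul]]
  unfold pa
  rw [← Finset.sum_fiberwise_of_maps_to fun I hI =>
    Finset.mem_image_of_mem (fun I : Fin r → ℤ => ∑ i, I i * v i) hI]
  refine Finset.sum_congr rfl fun d _ => ?_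
  rw [Qc, Finset.sum_mul]
  refine Finset.sum_congr rfl fun I hI => ?_
  rw [lmon_mul_zpow c v I ht, (Finset.mem_filter.1 hI).2, mul_assoc]

/-- The coset `C(c,v)` is disjoint from `Z(p_a)` if and only if there is exactly one
integer `d` with `Q_{a,v,d}(c) ≠ 0`. -/
theorem coset_disjoint_zero_set_iff {r : ℕ} (hr : 1 ≤ r)
    (S : Finset (Fin r → ℤ)) (a : (Fin r → ℤ) → ℂ)
    (c : Fin r → ℂ) (hc : ∀ i, c i ≠ 0) (v : Fin r → ℤ) (hv : v ≠ 0) :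
    Disjoint (coset c v) (Zset S a) ↔ ∃! d : ℤ, Qc S a v d c ≠ 0 := by
  have hdisj : Disjoint (coset c v) (Zset S a) ↔
      ∀ t : ℂ, t ≠ 0 → ∑ d ∈ degreeSupport S a v c, Qc S a v d c * t ^ d ≠ 0 := by
    rw [Set.disjoint_left]
    constructor
    · intro h t ht h0
      exact h ⟨t, ht, rfl⟩
        ⟨fun i => mul_ne_zero (hc i) (zpow_ne_zero _ ht), (pa_mul_zpow S a c v ht).trans h0⟩
    · rintro h _ ⟨t, ht, rfl⟩ ⟨-, h0⟩
      exact h t ht ((pa_mul_zpow S a c v ht).symm.trans h0)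
  rw [hdisj]
  constructor
  · intro h
    obtain ⟨m, hm⟩ := exists_eq_singleton_of_sum_zpow_ne_zero _ _
      (fun d hd => mem_degreeSupport.1 hd) h
    refine ⟨m, mem_degreeSupport.1 (by simp [hm]), fun d hd => ?_⟩
    simpa [hm] using mem_degreeSupport.2 hd
  · rintro ⟨m, hm, huniq⟩ t ht
    have hsingle : degreeSupport S a v c = {m} :=
      Finset.eq_singleton_iff_unique_mem.2
        ⟨mem_degreeSupport.2 hm, fun d hd => huniq d (mem_degreeSupport.1 hd)⟩
    rw [hsingle, Finset.sum_singleton]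
    exact mul_ne_zero hm (zpow_ne_zero _ ht)
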